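/- arXiv:math/0309327 — 6 statements merged into one kernel-verified Lean document; each statement's English description precedes it below -/
import Mathlib

section
/- Let G be a finite abelian group, K a field, and n ≥ 1 an integer. For a permutation σ of {1,…,n}, let 𝓘_σ : Gⁿ → Gⁿ be the automorphism (g₁,…,gₙ) ↦ (g_{σ(1)},…,g_{σ(n)}) and let Δ_{𝓘_σ} be the induced K-algebra automorphism of K[Gⁿ]. Then for every unit α ∈ K[G]ˣ and every permutation σ, Δ_{𝓘_σ}(λ(α)) = λ(α); that is, λ(α) is symmetric. -/
open scoped BigOperators

/-- For a subset `I ⊆ {1,…,n}`, the group homomorphism `δ_I : G → Gⁿ` sending `g`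
to the element whose `i`-th coordinate is `g` for `i ∈ I` and the identity otherwise. -/
def cubicDelta (G : Type*) [CommGroup G] {n : ℕ} (I : Finset (Fin n)) :
    G →* (Fin n → G) where
  toFun g i := if i ∈ I then g else 1
  map_one' := by funext i; simp
  map_mul' g h := by
    funext i
    by_cases hi : i ∈ I <;> simp [hi]

/-- The induced `K`-algebra homomorphism `Δ_I : K[G] → K[Gⁿ]` on units. -/
noncomputable def cubicDeltaUnits (G : Type*) [CommGroup G] (K : Type*) [Field K]
    {n : ℕ} (I : Finset (Fin n)) :
    (MonoidAlgebra K G)ˣ →* (MonoidAlgebra K (Fin n → G))ˣ :=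
  Units.map (MonoidAlgebra.mapDomainRingHom K (cubicDelta G I) : MonoidAlgebra K G →* MonoidAlgebra K (Fin n → G))

/-- `λ(α) = ∏_{I ⊆ {1,…,n}} Δ_I(α)^{(−1)^{n−#I}} ∈ K[Gⁿ]ˣ`. -/
noncomputable def cubicLambda (G : Type*) [CommGroup G] (K : Type*) [Field K]
    (n : ℕ) (α : (MonoidAlgebra K G)ˣ) : (MonoidAlgebra K (Fin n → G))ˣ :=
  ∏ I : Finset (Fin n), (cubicDeltaUnits G K I α) ^ ((-1 : ℤ) ^ (n - I.card))

/-- The automorphism `𝓘_σ : Gⁿ → Gⁿ`, `(g₁,…,gₙ) ↦ (g_{σ(1)},…,g_{σ(n)})`,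
associated to a permutation `σ` of `{1,…,n}`. -/
def cubicPerm (G : Type*) [CommGroup G] {n : ℕ} (σ : Equiv.Perm (Fin n)) :
    (Fin n → G) →* (Fin n → G) where
  toFun g := fun i => g (σ i)
  map_one' := rfl
  map_mul' _ _ := rfl

/-- Symmetry (condition 2 of being an `n`-cubic element): for any finite abelian
group `G`, field `K` and `n ≥ 1`, the `K`-algebra automorphism `Δ_{𝓘_σ}` of `K[Gⁿ]`
induced by a permutation `σ` of the coordinates fixes `λ(α)`, for every unit
`α ∈ K[G]ˣ` and every permutation `σ`. -/
theorem cubicLambda_symmetric (G : Type*) [CommGroup G] [Finite G] (K : Type*) [Field K]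
    (n : ℕ) (hn : 1 ≤ n) (α : (MonoidAlgebra K G)ˣ) (σ : Equiv.Perm (Fin n)) :
    MonoidAlgebra.mapDomainRingHom K (cubicPerm G σ)
        (↑(cubicLambda G K n α) : MonoidAlgebra K (Fin n → G)) =
      (↑(cubicLambda G K n α) : MonoidAlgebra K (Fin n → G)) := by
  have key : ∀ I : Finset (Fin n),
      Units.map (MonoidAlgebra.mapDomainRingHom K (cubicPerm G σ) :
        MonoidAlgebra K (Fin n → G) →* MonoidAlgebra K (Fin n → G))
        (cubicDeltaUnits G K I α) =
      cubicDeltaUnits G K (σ.symm.finsetCongr I) α := by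
    intro I
    have hc : (cubicPerm G σ).comp (cubicDelta G I) =
        cubicDelta G (σ.symm.finsetCongr I) := by
      ext g i
      simp [cubicPerm, cubicDelta, Finset.mem_map_equiv]
    ext1
    simp only [cubicDeltaUnits, Units.coe_map]
    rw [← hc]
    rw [MonoidAlgebra.mapDomainRingHom_comp]
    rfl
  have main : Units.map (MonoidAlgebra.mapDomainRingHom K (cubicPerm G σ) :
        MonoidAlgebra K (Fin n → G) →* MonoidAlgebra K (Fin n → G))
        (cubicLambda G K n α) = cubicLambda G K n α := by
    unfold cubicLambda
    rw [map_prod]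
    refine Fintype.prod_equiv σ.symm.finsetCongr _ _ fun I => ?_
    rw [map_zpow, key]
    simp
  exact congrArg Units.val main
end

section
/- Let G be a finite abelian group, K a field, and n ≥ 2 an integer. Define group homomorphisms 𝓘₀, 𝓘₁, 𝓘₂, 𝓘₃ : Gⁿ → G^{n+1} by 𝓘₀(g₁,…,gₙ) = (g₁,g₁,g₂,…,gₙ), 𝓘₁(g₁,…,gₙ) = (e,g₁,g₂,…,gₙ), 𝓘₂(g₁,…,gₙ) = (g₁,g₂,e,g₃,…,gₙ), 𝓘₃(g₁,…,gₙ) = (g₁,g₂,g₂,g₃,…,gₙ), and let Δ_{𝓘_j} : K[Gⁿ] → K[G^{n+1}] be the induced K-algebra homomorphisms. Then for every unit α ∈ K[G]ˣ, Δ_{𝓘₀}(λ(α)) · Δ_{𝓘₂}(λ(α)) = Δ_{𝓘₁}(λ(α)) · Δ_{𝓘₃}(λ(α)) in K[G^{n+1}]ˣ; that is, λ(α) satisfies the cocycle condition. -/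
open scoped BigOperators

/-- `𝓘₀ : Gⁿ → G^{n+1}`, `(g₁,…,gₙ) ↦ (g₁,g₁,g₂,…,gₙ)`. -/
def cubicI0 (G : Type*) [CommGroup G] (n : ℕ) (hn : 2 ≤ n) :
    (Fin n → G) →* (Fin (n + 1) → G) :=
  Pi.monoidHom fun j =>
    Pi.evalMonoidHom (fun _ : Fin n => G) ⟨j.val - 1, by have := j.isLt; omega⟩

/-- `𝓘₁ : Gⁿ → G^{n+1}`, `(g₁,…,gₙ) ↦ (e,g₁,g₂,…,gₙ)`. -/
def cubicI1 (G : Type*) [CommGroup G] (n : ℕ) (hn : 2 ≤ n) :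
    (Fin n → G) →* (Fin (n + 1) → G) :=
  Pi.monoidHom fun j =>
    if j.val = 0 then 1
    else Pi.evalMonoidHom (fun _ : Fin n => G) ⟨j.val - 1, by have := j.isLt; omega⟩

/-- `𝓘₂ : Gⁿ → G^{n+1}`, `(g₁,…,gₙ) ↦ (g₁,g₂,e,g₃,…,gₙ)`. -/
def cubicI2 (G : Type*) [CommGroup G] (n : ℕ) (hn : 2 ≤ n) :
    (Fin n → G) →* (Fin (n + 1) → G) :=
  Pi.monoidHom fun j =>
    if j.val = 2 then 1
    else if h : j.val < 2 then Pi.evalMonoidHom (fun _ : Fin n => G) ⟨j.val, by omega⟩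
    else Pi.evalMonoidHom (fun _ : Fin n => G) ⟨j.val - 1, by have := j.isLt; omega⟩

/-- `𝓘₃ : Gⁿ → G^{n+1}`, `(g₁,…,gₙ) ↦ (g₁,g₂,g₂,g₃,…,gₙ)`. -/
def cubicI3 (G : Type*) [CommGroup G] (n : ℕ) (hn : 2 ≤ n) :
    (Fin n → G) →* (Fin (n + 1) → G) :=
  Pi.monoidHom fun j =>
    if h : j.val < 2 then Pi.evalMonoidHom (fun _ : Fin n => G) ⟨j.val, by omega⟩
    else if j.val = 2 then Pi.evalMonoidHom (fun _ : Fin n => G) ⟨1, by omega⟩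
    else Pi.evalMonoidHom (fun _ : Fin n => G) ⟨j.val - 1, by have := j.isLt; omega⟩

/-- Boolean version of `cubicDelta`. -/
def cubicB (G : Type*) [CommGroup G] {n : ℕ} (p : Fin n → Bool) :
    G →* (Fin n → G) where
  toFun g i := if p i then g else 1
  map_one' := by funext i; simp
  map_mul' g h := by
    funext i
    by_cases hi : p i <;> simp [hi]

/-- Induced map on units. -/
noncomputable def cubicU (K : Type*) [Field K] {G H : Type*} [CommGroup G] [CommGroup H]
    (φ : G →* H) : (MonoidAlgebra K G)ˣ →* (MonoidAlgebra K H)ˣ :=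
  Units.map (MonoidAlgebra.mapDomainRingHom K φ : MonoidAlgebra K G →* MonoidAlgebra K H)

/-- sign -/
def cubicSgn {n : ℕ} (p : Fin n → Bool) : ℤ := ∏ i, if p i then 1 else -1

theorem cubicU_comp (K : Type*) [Field K] {G H L : Type*} [CommGroup G] [CommGroup H]
    [CommGroup L] (φ : G →* H) (ψ : H →* L) (α : (MonoidAlgebra K G)ˣ) :
    cubicU K ψ (cubicU K φ α) = cubicU K (ψ.comp φ) α := by
  ext1
  exact (DFunLike.congr_fun (MonoidAlgebra.mapDomainRingHom_comp (R := K) ψ φ) (α : MonoidAlgebra K G)).symm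

theorem cubicLambda_eq (G : Type*) [CommGroup G] (K : Type*) [Field K]
    (n : ℕ) (α : (MonoidAlgebra K G)ˣ) :
    cubicLambda G K n α = ∏ p : Fin n → Bool, (cubicU K (cubicB G p) α) ^ cubicSgn p := by
  unfold cubicLambda
  refine Finset.prod_bij' (fun I _ => fun i => decide (i ∈ I))
    (fun p _ => Finset.univ.filter (fun i => p i = true)) ?_ ?_ ?_ ?_ ?_
  · intros; simp
  · intros; simp
  · intro I _; ext i; simp
  · intro p _; ext i; simp
  · intro I _
    have h1 : cubicDelta G I = cubicB G (fun i => decide (i ∈ I)) := by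
      ext g i; simp [cubicDelta, cubicB]
    have h2 : (-1 : ℤ) ^ (n - I.card) = cubicSgn (fun i => decide (i ∈ I)) := by
      have h3 : (Finset.univ.filter (fun i => i ∉ I)) = Iᶜ := by ext; simp
      simp [cubicSgn, Finset.prod_ite, h3, Finset.card_compl]
    rw [h2, cubicDeltaUnits, h1]; rfl

theorem cubic_prod_cons {M : Type*} [CommMonoid M] {m : ℕ} (f : (Fin (m + 1) → Bool) → M) :
    ∏ p, f p = ∏ q : Fin m → Bool, f (Fin.cons true q) * f (Fin.cons false q) := by
  rw [← (Fin.consEquiv (fun _ : Fin (m + 1) => Bool)).prod_comp, Fintype.prod_prod_type_right]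
  simp [Fin.consEquiv]

theorem cubicSgn_cons {m : ℕ} (b : Bool) (q : Fin m → Bool) :
    cubicSgn (Fin.cons b q : Fin (m + 1) → Bool) = (if b then 1 else -1) * cubicSgn q := by
  simp [cubicSgn, Fin.prod_univ_succ]

theorem cubicU_lambda (G : Type*) [CommGroup G] (K : Type*) [Field K] {H : Type*} [CommGroup H]
    (m : ℕ) (α : (MonoidAlgebra K G)ˣ) (φ : (Fin (m + 2) → G) →* H)
    (D : Bool → Bool → (Fin m → Bool) → (G →* H))
    (hD : ∀ a b r, φ.comp (cubicB G (Fin.cons a (Fin.cons b r : Fin (m + 1) → Bool))) = D a b r) :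
    cubicU K φ (cubicLambda G K (m + 2) α) = ∏ r : Fin m → Bool,
      (cubicU K (D true true r) α * (cubicU K (D false true r) α)⁻¹
        * (cubicU K (D true false r) α)⁻¹ * cubicU K (D false false r) α) ^ cubicSgn r := by
  rw [cubicLambda_eq, map_prod, cubic_prod_cons, cubic_prod_cons]
  refine Finset.prod_congr rfl fun r _ => ?_
  simp only [map_zpow, cubicU_comp, hD, cubicSgn_cons]
  simp [mul_zpow, mul_assoc]

/-- The cocycle condition (condition 3 of being an `n`-cubic element): for any finite
abelian group `G`, field `K` and `n ≥ 2`, and every unit `α ∈ K[G]ˣ`, one has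
`Δ_{𝓘₀}(λ(α)) · Δ_{𝓘₂}(λ(α)) = Δ_{𝓘₁}(λ(α)) · Δ_{𝓘₃}(λ(α))` in `K[G^{n+1}]ˣ`. -/
theorem cubicLambda_cocycle (G : Type*) [CommGroup G] [Finite G] (K : Type*) [Field K]
    (n : ℕ) (hn : 2 ≤ n) (α : (MonoidAlgebra K G)ˣ) :
    MonoidAlgebra.mapDomainRingHom K (cubicI0 G n hn)
          (↑(cubicLambda G K n α) : MonoidAlgebra K (Fin n → G)) *
        MonoidAlgebra.mapDomainRingHom K (cubicI2 G n hn)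
          (↑(cubicLambda G K n α) : MonoidAlgebra K (Fin n → G)) =
      MonoidAlgebra.mapDomainRingHom K (cubicI1 G n hn)
          (↑(cubicLambda G K n α) : MonoidAlgebra K (Fin n → G)) *
        MonoidAlgebra.mapDomainRingHom K (cubicI3 G n hn)
          (↑(cubicLambda G K n α) : MonoidAlgebra K (Fin n → G)) := by
  obtain ⟨m, rfl⟩ : ∃ m, n = m + 2 := ⟨n - 2, by omega⟩
  have key : cubicU K (cubicI0 G (m + 2) hn) (cubicLambda G K (m + 2) α) *
      cubicU K (cubicI2 G (m + 2) hn) (cubicLambda G K (m + 2) α) =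
      cubicU K (cubicI1 G (m + 2) hn) (cubicLambda G K (m + 2) α) *
      cubicU K (cubicI3 G (m + 2) hn) (cubicLambda G K (m + 2) α) := by
    let D : Bool → Bool → Bool → (Fin m → Bool) → (G →* (Fin (m + 2 + 1) → G)) :=
      fun a b c r => cubicB G (Fin.cons a (Fin.cons b (Fin.cons c r : Fin (m + 1) → Bool) :
        Fin (m + 2) → Bool))
    have e1 : ∀ (k : ℕ) (h : k + 1 < m + 2), (⟨k + 1, h⟩ : Fin (m + 2)) =
      Fin.succ ⟨k, by omega⟩ := fun _ _ => rfl
    rw [cubicU_lambda G K m α (cubicI0 G (m + 2) hn) (fun a b r => D a a b r),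
      cubicU_lambda G K m α (cubicI1 G (m + 2) hn) (fun a b r => D false a b r),
      cubicU_lambda G K m α (cubicI2 G (m + 2) hn) (fun a b r => D a b false r),
      cubicU_lambda G K m α (cubicI3 G (m + 2) hn) (fun a b r => D a b b r)]
    · rw [← Finset.prod_mul_distrib, ← Finset.prod_mul_distrib]
      refine Finset.prod_congr rfl fun r _ => ?_
      rw [← mul_zpow, ← mul_zpow]
      congr 1
      generalize cubicU K (D true true true r) α = x1
      generalize cubicU K (D true true false r) α = x2
      generalize cubicU K (D true false true r) α = x3
      generalize cubicU K (D true false false r) α = x4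
      generalize cubicU K (D false true true r) α = x5
      generalize cubicU K (D false true false r) α = x6
      generalize cubicU K (D false false true r) α = x7
      generalize cubicU K (D false false false r) α = x8
      apply Additive.ofMul.injective
      simp only [ofMul_mul, ofMul_inv]
      abel
    all_goals
      intro a b r
      refine MonoidHom.ext fun g => funext fun j => ?_
      obtain ⟨j, hj⟩ := j
      rcases j with _ | _ | _ | j
      all_goals rfl
  exact congrArg Units.val key
end

section
/- Let Γ be a finite abelian group and H a subgroup of Γ. Let I_Γ be the augmentation ideal of the group ring ℤ[Γ], and let T_H = ∑_{h ∈ H} h ∈ ℤ[Γ]. Then every element x ∈ I_Γ satisfying h·x = x for all h ∈ H can be written as x = T_H · y for some y ∈ I_Γ. In other words, the Tate cohomology group Ĥ⁰(H, I_Γ) = (I_Γ)^H / T_H·I_Γ vanishes. -/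
open scoped BigOperators

/-- Let `Γ` be a finite abelian group, `H ⊆ Γ` a subgroup, `I_Γ` the augmentation
ideal of `ℤ[Γ]` (the kernel of the augmentation `ℤ[Γ] → ℤ`), and
`T_H = ∑_{h ∈ H} h ∈ ℤ[Γ]`. Then every `x ∈ I_Γ` satisfying `h·x = x` for all
`h ∈ H` can be written as `x = T_H · y` with `y ∈ I_Γ`; i.e. the Tate cohomology
group `Ĥ⁰(H, I_Γ) = (I_Γ)^H / T_H·I_Γ` vanishes. -/
theorem augmentationIdeal_tateH0_vanishes
    (Γ : Type*) [CommGroup Γ] [Fintype Γ] (H : Subgroup Γ) [Fintype H]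
    (x : MonoidAlgebra ℤ Γ)
    (hx : x ∈ RingHom.ker (MonoidAlgebra.lift ℤ ℤ Γ (1 : Γ →* ℤ)))
    (hfix : ∀ h : H, MonoidAlgebra.of ℤ Γ (h : Γ) * x = x) :
    ∃ y ∈ RingHom.ker (MonoidAlgebra.lift ℤ ℤ Γ (1 : Γ →* ℤ)),
      x = (∑ h : H, MonoidAlgebra.of ℤ Γ (h : Γ)) * y := by
  classical
  have hxc : ∀ (h : H) (g : Γ), x.coeff ((h : Γ) * g) = x.coeff g := by
    intro h g
    conv_lhs => rw [← hfix h]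
    rw [MonoidAlgebra.of_apply, MonoidAlgebra.single_mul_apply]
    simp
  set y : MonoidAlgebra ℤ Γ :=
    ∑ q : Γ ⧸ H, MonoidAlgebra.single (Quotient.out q) (x.coeff (Quotient.out q)) with hy
  have hbij : Function.Bijective (fun p : H × (Γ ⧸ H) => (p.1 : Γ) * Quotient.out p.2) := by
    constructor
    · rintro ⟨h, q⟩ ⟨h', q'⟩ e
      simp only at e
      have hq : q = q' := by
        have e2 : ((((h : Γ) * Quotient.out q : Γ)) : Γ ⧸ H)
            = (((h' : Γ) * Quotient.out q' : Γ) : Γ ⧸ H) := by rw [e]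
        rw [QuotientGroup.mk_mul, QuotientGroup.mk_mul,
          (QuotientGroup.eq_one_iff (h : Γ)).2 h.2, (QuotientGroup.eq_one_iff (h' : Γ)).2 h'.2,
          one_mul, one_mul, QuotientGroup.out_eq', QuotientGroup.out_eq'] at e2
        exact e2
      subst hq
      have := mul_right_cancel e
      exact Prod.ext (Subtype.ext this) rfl
    · intro g
      have hm : g * (Quotient.out (g : Γ ⧸ H))⁻¹ ∈ H := by
        rw [← QuotientGroup.eq_one_iff, QuotientGroup.mk_mul, QuotientGroup.mk_inv,
          QuotientGroup.out_eq', mul_inv_cancel]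
      exact ⟨(⟨_, hm⟩, (g : Γ ⧸ H)), by simp⟩
  have hxs : x = ∑ g : Γ, MonoidAlgebra.single g (x.coeff g) := by
    ext g
    simp [MonoidAlgebra.single_apply, Finsupp.finset_sum_apply]
  have hxy : x = (∑ h : H, MonoidAlgebra.of ℤ Γ (h : Γ)) * y := by
    conv_lhs => rw [hxs]
    rw [← hbij.sum_comp, Fintype.sum_prod_type, hy, Finset.sum_mul_sum]
    refine Finset.sum_congr rfl fun h _ => Finset.sum_congr rfl fun q _ => ?_
    rw [MonoidAlgebra.of_apply, MonoidAlgebra.single_mul_single, one_mul, hxc]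
  refine ⟨y, ?_, hxy⟩
  rw [RingHom.mem_ker] at hx ⊢
  rw [hxy, map_mul, map_sum] at hx
  simpa using hx
end

section
/- Let Γ be a finite abelian group and H a subgroup of Γ, acting on the augmentation ideal I_Γ of the group ring ℤ[Γ] by multiplication. Then the first group cohomology group H¹(H, I_Γ) is isomorphic, as an abelian group, to ℤ/(#H)ℤ. -/
/-- The augmentation ideal `I_Γ` of the integral group ring `ℤ[Γ]`: the kernel of the
ring homomorphism `ℤ[Γ] → ℤ` sending every group element to `1`. -/
noncomputable def augmentationIdeal (Γ : Type) [CommGroup Γ] : Ideal (MonoidAlgebra ℤ Γ) :=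
  RingHom.ker (MonoidAlgebra.lift ℤ ℤ Γ (1 : Γ →* ℤ))

/-- The representation of a subgroup `H ⊆ Γ` on an ideal `I ⊆ ℤ[Γ]` given by
multiplication by group elements of `H`. -/
noncomputable def idealRep (Γ : Type) [CommGroup Γ] (H : Subgroup Γ)
    (I : Ideal (MonoidAlgebra ℤ Γ)) : Representation ℤ H I where
  toFun h :=
    (DistribMulAction.toAddMonoidHom I
      (MonoidAlgebra.of ℤ Γ (h : Γ) : MonoidAlgebra ℤ Γ)).toIntLinearMap
  map_one' := by
    ext x
    simp
  map_mul' g h := by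
    ext x
    simp [mul_smul, mul_assoc]

namespace AugH1

open groupCohomology

/-- augmentation -/
noncomputable abbrev eps (Γ : Type) [CommGroup Γ] : MonoidAlgebra ℤ Γ →ₐ[ℤ] ℤ :=
  MonoidAlgebra.lift ℤ ℤ Γ (1 : Γ →* ℤ)

variable {Γ : Type} [CommGroup Γ] (H : Subgroup Γ)

theorem mem_aug (x : MonoidAlgebra ℤ Γ) : x ∈ augmentationIdeal Γ ↔ eps Γ x = 0 := Iff.rfl

theorem eps_of (g : Γ) : eps Γ (MonoidAlgebra.of ℤ Γ g) = 1 := by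
  simp [eps]

theorem exists_r : ∃ r : Γ → H, ∀ (h : H) (γ : Γ), r (h * γ) = h * r γ := by
  refine ⟨fun γ => ⟨γ * (Quotient.out (QuotientGroup.mk γ : Γ ⧸ H))⁻¹, ?_⟩, ?_⟩
  · have := QuotientGroup.eq.1 (QuotientGroup.out_eq' (QuotientGroup.mk γ : Γ ⧸ H))
    rwa [mul_comm] at this
  · intro h γ
    have : (QuotientGroup.mk ((h : Γ) * γ) : Γ ⧸ H) = QuotientGroup.mk γ := by
      rw [QuotientGroup.eq]; simp
    ext
    simp [this, mul_assoc]

theorem coeff_of_mul (g : Γ) (x : MonoidAlgebra ℤ Γ) (γ : Γ) :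
    (MonoidAlgebra.of ℤ Γ g * x).coeff γ = x.coeff (g⁻¹ * γ) := by
  simp [MonoidAlgebra.of]

/-- `H¹(H, ℤ[Γ]) = 0`. -/
theorem exists_prim [Finite Γ] (f : H → MonoidAlgebra ℤ Γ)
    (hf : ∀ g h : H, f (g * h) = MonoidAlgebra.of ℤ Γ (g : Γ) * f h + f g) :
    ∃ x : MonoidAlgebra ℤ Γ, ∀ h : H, f h = MonoidAlgebra.of ℤ Γ (h : Γ) * x - x := by
  obtain ⟨r, hr⟩ := exists_r H
  refine ⟨MonoidAlgebra.ofCoeff (Finsupp.equivFunOnFinite.symm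
    fun γ => - (f (r γ)).coeff γ), fun h => ?_⟩
  ext γ
  have h1 := hf h (r ((h : Γ)⁻¹ * γ))
  rw [← hr, mul_inv_cancel_left] at h1
  have h2 := congrArg (fun z => z.coeff γ) h1
  simp only [MonoidAlgebra.coeff_add, Finsupp.add_apply, coeff_of_mul] at h2
  simp only [MonoidAlgebra.coeff_sub, Finsupp.sub_apply, coeff_of_mul,
    MonoidAlgebra.coeff_ofCoeff, Finsupp.equivFunOnFinite_symm_apply_apply]
  linarith

theorem dvd_eps [Finite Γ] (z : MonoidAlgebra ℤ Γ)
    (hz : ∀ h : H, MonoidAlgebra.of ℤ Γ (h : Γ) * z = z) : (Nat.card H : ℤ) ∣ eps Γ z := by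
  classical
  have := Fintype.ofFinite Γ
  have := Fintype.ofFinite H
  have := Fintype.ofFinite (Γ ⧸ H)
  let e : (Γ ⧸ H) × H → Γ := fun p => p.2 * p.1.out
  have he : Function.Bijective e := by
    constructor
    · rintro ⟨q, h⟩ ⟨q', h'⟩ hh
      simp only [e] at hh
      have hq : ∀ (q : Γ ⧸ H) (h : H), (QuotientGroup.mk ((h : Γ) * q.out) : Γ ⧸ H) = q := by
        intro q h
        conv_rhs => rw [← QuotientGroup.out_eq' q]
        rw [QuotientGroup.eq]; simp
      have h1 := hq q h
      rw [hh, hq] at h1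
      subst h1
      simpa using hh
    · intro γ
      refine ⟨⟨QuotientGroup.mk γ, ⟨γ * (Quotient.out (QuotientGroup.mk γ : Γ ⧸ H))⁻¹, ?_⟩⟩, ?_⟩
      · have := QuotientGroup.eq.1 (QuotientGroup.out_eq' (QuotientGroup.mk γ : Γ ⧸ H))
        rwa [mul_comm] at this
      · simp [e]
  have h1 : eps Γ z = ∑ γ, z.coeff γ := by
    rw [eps, MonoidAlgebra.lift_apply, Finsupp.sum_fintype] <;> simp
  have h2 : ∀ (h : H) (γ : Γ), z.coeff (h * γ) = z.coeff γ := by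
    intro h γ
    conv_lhs => rw [← hz h, coeff_of_mul]
    simp
  rw [h1, ← (Equiv.ofBijective e he).sum_comp, Fintype.sum_prod_type]
  simp only [Equiv.ofBijective_apply, e, h2, Finset.sum_const, Finset.card_univ,
    nsmul_eq_mul, Nat.card_eq_fintype_card]
  exact Finset.dvd_sum fun _ _ => dvd_mul_right _ _

theorem exists_norm [Finite Γ] : ∃ z : MonoidAlgebra ℤ Γ,
    (∀ h : H, MonoidAlgebra.of ℤ Γ (h : Γ) * z = z) ∧ eps Γ z = Nat.card H := by
  have := Fintype.ofFinite H
  refine ⟨∑ h : H, MonoidAlgebra.of ℤ Γ (h : Γ), fun h => ?_, ?_⟩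
  · rw [Finset.mul_sum, ← Equiv.sum_comp (Equiv.mulLeft h) (fun h : H => MonoidAlgebra.of ℤ Γ (h : Γ))]
    simp only [← map_mul, Equiv.coe_mulLeft, Subgroup.coe_mul]
  · rw [map_sum]
    simp only [eps_of]
    simp

/-- the representation -/
noncomputable abbrev R : Rep ℤ H := Rep.of (idealRep Γ H (augmentationIdeal Γ))

theorem rho_coe (h : H) (x : augmentationIdeal Γ) :
    ((idealRep Γ H (augmentationIdeal Γ) h x : augmentationIdeal Γ) : MonoidAlgebra ℤ Γ)
      = MonoidAlgebra.of ℤ Γ (h : Γ) * x := rfl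

/-- basic cocycle function -/
noncomputable def b (h : H) : augmentationIdeal Γ :=
  ⟨MonoidAlgebra.of ℤ Γ (h : Γ) - 1, by rw [mem_aug, map_sub, eps_of, map_one, sub_self]⟩

/-- basic cocycle -/
noncomputable def c : cocycles₁ (R H) :=
  ⟨b H, (mem_cocycles₁_iff (A := R H) _).2 fun g h => by
    apply Subtype.ext
    change MonoidAlgebra.of ℤ Γ ((g * h : H) : Γ) - 1 =
      MonoidAlgebra.of ℤ Γ (g : Γ) * (MonoidAlgebra.of ℤ Γ (h : Γ) - 1)
        + (MonoidAlgebra.of ℤ Γ (g : Γ) - 1)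
    rw [Subgroup.coe_mul, map_mul]; ring⟩

theorem mem_cob (f : H → augmentationIdeal Γ) :
    f ∈ coboundaries₁ (R H) ↔ ∃ y : MonoidAlgebra ℤ Γ, eps Γ y = 0 ∧
      ∀ h : H, (f h : MonoidAlgebra ℤ Γ) = MonoidAlgebra.of ℤ Γ (h : Γ) * y - y := by
  constructor
  · rintro ⟨y, hy⟩
    refine ⟨(y : augmentationIdeal Γ).1, (y : augmentationIdeal Γ).2, fun h => ?_⟩
    rw [← hy]; rfl
  · rintro ⟨y, hy, hf⟩
    refine ⟨(⟨y, hy⟩ : augmentationIdeal Γ), ?_⟩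
    funext h
    apply Subtype.ext
    rw [hf]; rfl

/-- the map from the integers -/
noncomputable def psi : ℤ →+ groupCohomology (R H) 1 :=
  zmultiplesHom _ (H1π (R H) (c H))

theorem psi_apply (n : ℤ) : psi H n = H1π (R H) (n • c H) := by
  refine Eq.trans ?_ ((H1π (R H)).hom.map_smul n (c H)).symm
  exact (int_smul_eq_zsmul _ n _).symm

theorem psi_surj [Finite Γ] : Function.Surjective (psi H) := by
  intro x
  induction x using H1_induction_on with
  | h f =>
    let f' : H → augmentationIdeal Γ := f.1
    obtain ⟨x, hx⟩ := exists_prim H (fun h => (f' h : MonoidAlgebra ℤ Γ)) fun g h =>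
      congrArg Subtype.val ((mem_cocycles₁_iff (A := R H) _).1 f.2 g h)
    refine ⟨eps Γ x, ?_⟩
    rw [psi_apply, H1π_eq_iff]
    refine (mem_cob H (fun h => eps Γ x • b H h - f' h)).2 ⟨(eps Γ x : ℤ) • 1 - x, ?_, fun h => ?_⟩
    · simp
    · have := hx h
      have hb : ((eps Γ x • b H h : augmentationIdeal Γ) : MonoidAlgebra ℤ Γ) =
          (eps Γ x : ℤ) * (MonoidAlgebra.of ℤ Γ (h : Γ) - 1) := by
        rw [← zsmul_eq_mul]; rfl
      rw [AddSubgroupClass.coe_sub, this, hb, zsmul_eq_mul]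
      ring

theorem psi_ker [Finite Γ] : (psi H).ker = AddSubgroup.zmultiples ((Nat.card H : ℕ) : ℤ) := by
  ext n
  rw [AddMonoidHom.mem_ker, Int.mem_zmultiples_iff, psi_apply, H1π_eq_zero_iff]
  refine (mem_cob H (fun h => n • b H h)).trans ?_
  have hb : ∀ h : H, ((n • b H h : augmentationIdeal Γ) : MonoidAlgebra ℤ Γ) =
    n * (MonoidAlgebra.of ℤ Γ (h : Γ) - 1) := fun h => by
      rw [← zsmul_eq_mul]; rfl
  simp only [hb]
  constructor
  · rintro ⟨y, hy, h⟩
    have := dvd_eps H ((n : MonoidAlgebra ℤ Γ) - y) fun g => by linear_combination h g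
    rwa [map_sub, hy, sub_zero, map_intCast] at this
  · rintro ⟨m, rfl⟩
    obtain ⟨z, hz, hz'⟩ := exists_norm H
    refine ⟨((Nat.card H * m : ℤ) : MonoidAlgebra ℤ Γ) - m * z, ?_, fun h => ?_⟩
    · rw [map_sub, map_mul, hz', map_intCast, map_intCast]; simp; ring
    · linear_combination (m : MonoidAlgebra ℤ Γ) * hz h

end AugH1

/-- Let `Γ` be a finite abelian group and `H ⊆ Γ` a subgroup, acting on the
augmentation ideal `I_Γ` of `ℤ[Γ]` by multiplication. Then the first group
cohomology `H¹(H, I_Γ)` is isomorphic, as an abelian group, to `ℤ/#H`. -/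
theorem groupCohomology_one_augmentationIdeal
    (Γ : Type) [CommGroup Γ] [Finite Γ] (H : Subgroup Γ) :
    Nonempty
      ((groupCohomology (Rep.of (idealRep Γ H (augmentationIdeal Γ))) 1) ≃+
        ZMod (Nat.card H)) := by
  exact ⟨(QuotientAddGroup.quotientKerEquivOfSurjective _ (AugH1.psi_surj H)).symm.trans
    ((QuotientAddGroup.quotientAddEquivOfEq (AugH1.psi_ker H)).trans
      (Int.quotientZMultiplesNatEquivZMod _))⟩
end

section
/- Let Γ be a finite abelian group, p a prime, and ψ : Γ → (ℤ/pℤ)ˣ a group homomorphism. Let 𝒥 be the kernel of the ring homomorphism ℤ[Γ] → ℤ/pℤ sending each g ∈ Γ to ψ(g), and let I_Γ be the augmentation ideal of ℤ[Γ]. Let H be a subgroup of Γ such that the restriction of ψ to H is nontrivial. Then the first group cohomology group H¹(H, I_Γ ∩ 𝒥) (with H acting by multiplication) is a cyclic group whose order divides #H. -/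
/-- The ideal `𝒥 ⊆ ℤ[Γ]`: the kernel of the ring homomorphism `ℤ[Γ] → ℤ/pℤ`
sending each `g ∈ Γ` to `ψ(g)`. -/
noncomputable def charKernelIdeal (Γ : Type) [CommGroup Γ] (p : ℕ)
    (ψ : Γ →* (ZMod p)ˣ) : Ideal (MonoidAlgebra ℤ Γ) :=
  RingHom.ker (MonoidAlgebra.lift ℤ (ZMod p) Γ ((Units.coeHom (ZMod p)).comp ψ))

open groupCohomology in
theorem aux_exists_primitive (Γ : Type) [CommGroup Γ] [Finite Γ] (H : Subgroup Γ)
    (f : H → MonoidAlgebra ℤ Γ)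
    (hf : ∀ g h : H, f (g * h) = MonoidAlgebra.of ℤ Γ (g : Γ) * f h + f g) :
    ∃ y : MonoidAlgebra ℤ Γ, ∀ h : H, f h = MonoidAlgebra.of ℤ Γ (h : Γ) * y - y := by
  classical
  have hk : ∃ k : Γ → H, ∀ (h : H) (γ : Γ), k ((h : Γ) * γ) = h * k γ := by
    have hmem : ∀ γ : Γ, γ * ((QuotientGroup.mk γ : Γ ⧸ H).out)⁻¹ ∈ H := by
      intro γ
      have := QuotientGroup.mk_out_eq_mul H γ
      obtain ⟨h, hh⟩ := this
      rw [hh]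
      simp
    refine ⟨fun γ => ⟨_, hmem γ⟩, fun h γ => ?_⟩
    have : (QuotientGroup.mk ((h : Γ) * γ) : Γ ⧸ H) = QuotientGroup.mk γ := by
      rw [mul_comm, QuotientGroup.eq]
      simp
    ext
    simp only [this, Subgroup.coe_mul, mul_assoc]
  obtain ⟨k, hk⟩ := hk
  refine ⟨MonoidAlgebra.ofCoeff (Finsupp.equivFunOnFinite.symm
    (fun γ => - (f (k γ)).coeff γ)), fun h => ?_⟩
  apply MonoidAlgebra.coeff_injective
  ext γ
  have h1 := hf h (h⁻¹ * k γ)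
  rw [mul_inv_cancel_left] at h1
  have h2 := hk h⁻¹ γ
  have h3 := congrArg (fun x => x.coeff γ) h1
  simp only [MonoidAlgebra.of_apply, MonoidAlgebra.coeff_add, MonoidAlgebra.coeff_sub,
    Finsupp.add_apply, Finsupp.sub_apply, MonoidAlgebra.coeff_single_mul_apply, one_mul,
    Finsupp.equivFunOnFinite_symm_apply_apply] at h3 ⊢
  simp only [Subgroup.coe_inv] at h2
  rw [h2]
  linarith

theorem aux_cob (Γ : Type) [CommGroup Γ] (H : Subgroup Γ) (I : Ideal (MonoidAlgebra ℤ Γ))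
    (z : groupCohomology.cocycles₁ (Rep.of (idealRep Γ H I)))
    (x : MonoidAlgebra ℤ Γ) (hx : x ∈ I)
    (hz : ∀ h : H, ((z h : I) : MonoidAlgebra ℤ Γ) = MonoidAlgebra.of ℤ Γ (h : Γ) * x - x) :
    groupCohomology.H1π _ z = 0 := by
  rw [groupCohomology.H1π_eq_zero_iff]
  refine ⟨(⟨x, hx⟩ : I), ?_⟩
  funext h
  apply Subtype.ext
  exact (hz h).symm

/-- Let `Γ` be a finite abelian group, `p` a prime and `ψ : Γ → (ℤ/pℤ)ˣ` a
homomorphism; let `𝒥` be the kernel of the induced ring homomorphism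
`ℤ[Γ] → ℤ/pℤ` and `I_Γ` the augmentation ideal. If `H ⊆ Γ` is a subgroup on which
`ψ` is nontrivial, then `H¹(H, I_Γ ∩ 𝒥)` (with `H` acting by multiplication) is a
cyclic group whose order divides `#H`. -/
theorem groupCohomology_one_inf_cyclic
    (Γ : Type) [CommGroup Γ] [Finite Γ] (p : ℕ) (hp : p.Prime)
    (ψ : Γ →* (ZMod p)ˣ) (H : Subgroup Γ) (hH : ∃ h : H, ψ (h : Γ) ≠ 1) :
    IsAddCyclic
        (groupCohomology
          (Rep.of (idealRep Γ H (augmentationIdeal Γ ⊓ charKernelIdeal Γ p ψ))) 1) ∧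
      Nat.card
          (groupCohomology
            (Rep.of (idealRep Γ H (augmentationIdeal Γ ⊓ charKernelIdeal Γ p ψ))) 1) ∣
        Nat.card H := by
  classical
  set I := augmentationIdeal Γ ⊓ charKernelIdeal Γ p ψ with hI
  haveI : Fact p.Prime := ⟨hp⟩
  haveI := Fintype.ofFinite H
  let ε := MonoidAlgebra.lift ℤ ℤ Γ (1 : Γ →* ℤ)
  let φ := MonoidAlgebra.lift ℤ (ZMod p) Γ ((Units.coeHom (ZMod p)).comp ψ)
  have hmem : ∀ x, x ∈ I ↔ ε x = 0 ∧ φ x = 0 := fun x => Iff.rfl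
  have hεof : ∀ γ, ε (MonoidAlgebra.of ℤ Γ γ) = 1 := fun γ => by simp [ε]
  have hφof : ∀ γ, φ (MonoidAlgebra.of ℤ Γ γ) = (ψ γ : ZMod p) := fun γ => by simp [φ]
  -- every cocycle comes from an element of the kernel of φ
  have key : ∀ z : groupCohomology.cocycles₁ (Rep.of (idealRep Γ H I)),
      ∃ y : MonoidAlgebra ℤ Γ, φ y = 0 ∧
        ∀ h : H, ((z h : I) : MonoidAlgebra ℤ Γ) = MonoidAlgebra.of ℤ Γ (h : Γ) * y - y := by
    intro z
    obtain ⟨y, hy⟩ := aux_exists_primitive Γ H (fun h => ((z h : I) : MonoidAlgebra ℤ Γ))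
      (fun g h => congrArg Subtype.val ((groupCohomology.mem_cocycles₁_iff z).1 z.2 g h))
    refine ⟨y, ?_, hy⟩
    obtain ⟨h, hh⟩ := hH
    have h1 := ((hmem _).1 (z h : I).2).2
    rw [hy h, map_sub, map_mul, hφof, ← sub_one_mul] at h1
    refine (mul_eq_zero.1 h1).resolve_left fun h2 => hh ?_
    ext
    simpa using sub_eq_zero.1 h2
  -- an element of the kernel of φ gives a cocycle
  have mk : ∀ y : MonoidAlgebra ℤ Γ, φ y = 0 →
      ∃ z : groupCohomology.cocycles₁ (Rep.of (idealRep Γ H I)),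
        ∀ h : H, ((z h : I) : MonoidAlgebra ℤ Γ) = MonoidAlgebra.of ℤ Γ (h : Γ) * y - y := by
    intro y hy
    have hm : ∀ h : H, MonoidAlgebra.of ℤ Γ (h : Γ) * y - y ∈ I := fun h => by
      rw [hmem]
      constructor
      · rw [map_sub, map_mul, hεof, one_mul, sub_self]
      · rw [map_sub, map_mul, hy, mul_zero, sub_self]
    refine ⟨⟨fun h => (⟨_, hm h⟩ : I), ?_⟩, fun h => rfl⟩
    rw [groupCohomology.mem_cocycles₁_iff]
    intro g h
    apply Subtype.ext
    change MonoidAlgebra.of ℤ Γ ((g * h : H) : Γ) * y - y =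
      MonoidAlgebra.of ℤ Γ (g : Γ) * (MonoidAlgebra.of ℤ Γ (h : Γ) * y - y) +
        (MonoidAlgebra.of ℤ Γ (g : Γ) * y - y)
    rw [Subgroup.coe_mul, map_mul]
    ring
  -- a generator of ε(J)
  obtain ⟨d, hd, hgen⟩ : ∃ d, φ d = 0 ∧ ∀ y, φ y = 0 → ∃ k : ℤ, ε y = k * ε d := by
    let S : Ideal ℤ := Ideal.map ε (RingHom.ker φ)
    have hsurj : Function.Surjective ε := fun n => ⟨n • 1, by simp⟩
    obtain ⟨a, ha⟩ := (IsPrincipalIdealRing.principal S).principal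
    have ha' : a ∈ S := ha ▸ Submodule.mem_span_singleton_self a
    obtain ⟨d, hd, rfl⟩ := (Ideal.mem_map_iff_of_surjective ε hsurj).1 ha'
    refine ⟨d, hd, fun y hy => ?_⟩
    have : ε y ∈ S := Ideal.mem_map_of_mem ε hy
    rw [ha, Submodule.mem_span_singleton] at this
    obtain ⟨k, hk⟩ := this
    exact ⟨k, hk.symm⟩
  obtain ⟨zd, hzd⟩ := mk d hd
  have hcyc : ∀ x : groupCohomology (Rep.of (idealRep Γ H I)) 1,
      ∃ k : ℤ, k • groupCohomology.H1π _ zd = x := by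
    intro x
    induction x using groupCohomology.H1_induction_on with
    | h z =>
      obtain ⟨y, hy, hz⟩ := key z
      obtain ⟨k, hk⟩ := hgen y hy
      refine ⟨k, ?_⟩
      rw [eq_comm, ← sub_eq_zero, ← map_zsmul, ← map_sub]
      refine aux_cob Γ H I _ (y - k • d) ?_ fun h => ?_
      · rw [hmem]
        simp [hk, hy, hd]
      · change ((z h : I) : MonoidAlgebra ℤ Γ) - k • ((zd h : I) : MonoidAlgebra ℤ Γ) = _
        rw [hz, hzd, mul_sub, smul_sub, mul_smul_comm]
        abel
  have hkill : ∀ x : groupCohomology (Rep.of (idealRep Γ H I)) 1, Nat.card H • x = 0 := by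
    intro x
    induction x using groupCohomology.H1_induction_on with
    | h z =>
      obtain ⟨y, hy, hz⟩ := key z
      rw [← map_nsmul]
      let N : MonoidAlgebra ℤ Γ := ∑ h : H, MonoidAlgebra.of ℤ Γ (h : Γ)
      have hN : ∀ h : H, MonoidAlgebra.of ℤ Γ (h : Γ) * N = N := fun h => by
        simp only [N, Finset.mul_sum, ← map_mul, ← Subgroup.coe_mul]
        exact Fintype.sum_equiv (Equiv.mulLeft h) _ _ fun _ => rfl
      have hεN : ε N = Nat.card H := by
        simp only [N, map_sum, hεof]
        simp
      refine aux_cob Γ H I _ (Nat.card H • y - N * y) ?_ fun h => ?_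
      · rw [hmem]
        constructor
        · rw [map_sub, map_mul, hεN, map_nsmul, nsmul_eq_mul, sub_self]
        · rw [map_sub, map_mul, map_nsmul, hy, smul_zero, mul_zero, sub_zero]
      · change Nat.card H • ((z h : I) : MonoidAlgebra ℤ Γ) = _
        rw [hz, mul_sub, smul_sub, mul_smul_comm, ← mul_assoc, hN]
        abel
  refine ⟨⟨groupCohomology.H1π _ zd, hcyc⟩, ?_⟩
  rw [← addOrderOf_eq_card_of_forall_mem_zmultiples hcyc]
  exact addOrderOf_dvd_of_nsmul_eq_zero (hkill _)
end

section
/- Let Γ be a finite abelian group, p a prime, and ψ : Γ → (ℤ/pℤ)ˣ a group homomorphism. Let 𝒥 be the kernel of the ring homomorphism ℤ[Γ] → ℤ/pℤ sending each g ∈ Γ to ψ(g), and let I_Γ be the augmentation ideal of ℤ[Γ]. Let H be a subgroup of Γ such that the restriction of ψ to H is nontrivial, and let T_H = ∑_{h ∈ H} h ∈ ℤ[Γ]. Suppose M is a ℤ[Γ]-module fitting into a short exact sequence of ℤ[Γ]-modules 0 → I_Γ ∩ 𝒥 → I_Γ → M → 0 (i.e. M is the cokernel of some injective ℤ[Γ]-linear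 map I_Γ ∩ 𝒥 → I_Γ). Then the Tate cohomology group Ĥ⁰(H, M) = M^H / T_H·M is a cyclic group whose order divides #H. -/
open scoped BigOperators

/-- The subgroup `M^H` of `H`-fixed elements of a `ℤ[Γ]`-module `M`. -/
def fixedAddSubgroup (Γ : Type) [CommGroup Γ] (H : Subgroup Γ) (M : Type)
    [AddCommGroup M] [Module (MonoidAlgebra ℤ Γ) M] : AddSubgroup M where
  carrier := {x | ∀ h : H, (MonoidAlgebra.of ℤ Γ (h : Γ)) • x = x}
  add_mem' := fun {a b} ha hb h => by rw [smul_add, ha h, hb h]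
  zero_mem' := fun h => smul_zero _
  neg_mem' := fun {a} ha h => by rw [smul_neg, ha h]

/-- The subgroup `T_H·M` of a `ℤ[Γ]`-module `M`, the image of multiplication by the
trace element `T_H = ∑_{h ∈ H} h`. -/
noncomputable def traceAddSubgroup (Γ : Type) [CommGroup Γ] (H : Subgroup Γ) [Fintype H]
    (M : Type) [AddCommGroup M] [Module (MonoidAlgebra ℤ Γ) M] : AddSubgroup M :=
  (DistribMulAction.toAddMonoidHom M
    (∑ h : H, MonoidAlgebra.of ℤ Γ (h : Γ))).range


set_option linter.unusedSectionVars false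

namespace TateAux

variable {Γ : Type} [CommGroup Γ] [Fintype Γ] (H : Subgroup Γ)

/-- coset representative -/
noncomputable def rep (γ : Γ) : Γ := (QuotientGroup.mk γ : Γ ⧸ H).out

lemma rep_mul (h : H) (γ : Γ) : rep H ((h : Γ) * γ) = rep H γ := by
  unfold rep
  congr 1
  rw [QuotientGroup.eq]
  simp

lemma rep_mem (γ : Γ) : rep H γ * γ⁻¹ ∈ H := by
  obtain ⟨h, hh⟩ := QuotientGroup.mk_out_eq_mul H γ
  unfold rep
  rw [hh]
  simp

lemma coeff_of_mul (h γ : Γ) (x : MonoidAlgebra ℤ Γ) :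
    (MonoidAlgebra.of ℤ Γ h * x).coeff γ = x.coeff (h⁻¹ * γ) := by
  simp [MonoidAlgebra.of_apply]

lemma ext_coeff {x y : MonoidAlgebra ℤ Γ} (h : ∀ γ, x.coeff γ = y.coeff γ) : x = y := by
  apply MonoidAlgebra.coeff_injective
  ext γ
  exact h γ

/-- an element with prescribed coefficients -/
noncomputable def ofFun (a : Γ → ℤ) : MonoidAlgebra ℤ Γ :=
  MonoidAlgebra.ofCoeff (Finsupp.equivFunOnFinite.symm a)

lemma coeff_ofFun (a : Γ → ℤ) (γ : Γ) : (ofFun a).coeff γ = a γ := rfl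

/-- vanishing of `H^1(H, ℤ[Γ])`. -/
lemma cocycle (n : H → MonoidAlgebra ℤ Γ)
    (hn : ∀ k h : H, n (k * h) = n k + MonoidAlgebra.of ℤ Γ (k : Γ) * n h) :
    ∃ r : MonoidAlgebra ℤ Γ, ∀ h : H, n h = MonoidAlgebra.of ℤ Γ (h : Γ) * r - r := by
  refine ⟨ofFun fun γ => (n ⟨rep H γ * γ⁻¹, rep_mem H γ⟩).coeff (rep H γ), fun h => ?_⟩
  apply ext_coeff
  intro γ
  rw [MonoidAlgebra.coeff_sub, Finsupp.sub_apply, coeff_of_mul, coeff_ofFun, coeff_ofFun]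
  have h1 : rep H ((h : Γ)⁻¹ * γ) = rep H γ := by
    simpa using rep_mul H h⁻¹ γ
  have h2 : (⟨rep H ((h : Γ)⁻¹ * γ) * ((h : Γ)⁻¹ * γ)⁻¹, rep_mem H _⟩ : H) =
      ⟨rep H γ * γ⁻¹, rep_mem H γ⟩ * h := by
    apply Subtype.ext
    simp [h1, mul_assoc]
  rw [h2, hn, h1, MonoidAlgebra.coeff_add, Finsupp.add_apply, coeff_of_mul]
  simp

/-- vanishing of `Ĥ^0(H, ℤ[Γ])`. -/
lemma fixed [Fintype H] (r : MonoidAlgebra ℤ Γ)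
    (hr : ∀ h : H, MonoidAlgebra.of ℤ Γ (h : Γ) * r = r) :
    ∃ y, r = (∑ h : H, MonoidAlgebra.of ℤ Γ (h : Γ)) * y := by
  classical
  refine ⟨ofFun fun γ => if rep H γ = γ then r.coeff γ else 0, ?_⟩
  apply ext_coeff
  intro γ
  rw [Finset.sum_mul, MonoidAlgebra.coeff_sum, Finsupp.finsetSum_apply]
  have key : ∀ h : H, (MonoidAlgebra.of ℤ Γ (h : Γ) *
      ofFun fun γ => if rep H γ = γ then r.coeff γ else 0).coeff γ =
      if h = (⟨rep H γ * γ⁻¹, rep_mem H γ⟩ : H)⁻¹ then r.coeff γ else 0 := by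
    intro h
    rw [coeff_of_mul, coeff_ofFun]
    have h1 : rep H ((h : Γ)⁻¹ * γ) = rep H γ := by
      simpa using rep_mul H h⁻¹ γ
    rw [h1, ← coeff_of_mul, hr h]
    have : (rep H γ = (h : Γ)⁻¹ * γ) ↔ h = (⟨rep H γ * γ⁻¹, rep_mem H γ⟩ : H)⁻¹ := by
      rw [← inv_eq_iff_eq_inv, Subtype.ext_iff]
      simp only [InvMemClass.coe_inv]
      rw [eq_mul_inv_iff_mul_eq, eq_comm]
    simp only [this]
  simp only [key]
  simp

variable {H}

/-- augmentation -/
noncomputable abbrev aug : MonoidAlgebra ℤ Γ →ₐ[ℤ] ℤ := MonoidAlgebra.lift ℤ ℤ Γ (1 : Γ →* ℤ)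

lemma aug_of (γ : Γ) : aug (MonoidAlgebra.of ℤ Γ γ) = 1 := by
  simp [aug]

lemma aug_T [Fintype H] : aug (∑ h : H, MonoidAlgebra.of ℤ Γ (h : Γ)) = (Nat.card H : ℤ) := by
  rw [map_sum]
  simp only [aug_of]
  simp

lemma T_fixed [Fintype H] (h : H) : MonoidAlgebra.of ℤ Γ (h : Γ) *
    (∑ k : H, MonoidAlgebra.of ℤ Γ (k : Γ)) = ∑ k : H, MonoidAlgebra.of ℤ Γ (k : Γ) := by
  rw [Finset.mul_sum]
  refine Fintype.sum_equiv (Equiv.mulLeft h) _ _ fun k => ?_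
  rw [← map_mul]
  simp

lemma mem_aug {x : MonoidAlgebra ℤ Γ} : x ∈ augmentationIdeal Γ ↔ aug x = 0 := Iff.rfl

variable {p : ℕ} {ψ : Γ →* (ZMod p)ˣ} {M : Type} [AddCommGroup M] [Module (MonoidAlgebra ℤ Γ) M]

/-- the connecting relation -/
def Rel (H : Subgroup Γ)
    (f : ↥(augmentationIdeal Γ ⊓ charKernelIdeal Γ p ψ) →ₗ[MonoidAlgebra ℤ Γ]
          ↥(augmentationIdeal Γ))
    (g : ↥(augmentationIdeal Γ) →ₗ[MonoidAlgebra ℤ Γ] M) (m : M) (z : ℤ) : Prop :=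
  ∃ (x : augmentationIdeal Γ) (r : MonoidAlgebra ℤ Γ), g x = m ∧ aug r = z ∧
    ∀ h : H, ∃ n : ↥(augmentationIdeal Γ ⊓ charKernelIdeal Γ p ψ),
      (n : MonoidAlgebra ℤ Γ) = MonoidAlgebra.of ℤ Γ (h : Γ) * r - r ∧
      f n = MonoidAlgebra.of ℤ Γ (h : Γ) • x - x

variable {f : ↥(augmentationIdeal Γ ⊓ charKernelIdeal Γ p ψ) →ₗ[MonoidAlgebra ℤ Γ]
          ↥(augmentationIdeal Γ)}
    {g : ↥(augmentationIdeal Γ) →ₗ[MonoidAlgebra ℤ Γ] M}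

lemma Rel.add {m m' : M} {z z' : ℤ} (h1 : Rel H f g m z) (h2 : Rel H f g m' z') :
    Rel H f g (m + m') (z + z') := by
  obtain ⟨x, r, hx, hr, h⟩ := h1
  obtain ⟨x', r', hx', hr', h'⟩ := h2
  refine ⟨x + x', r + r', by simp [hx, hx'], by rw [map_add, hr, hr'], fun k => ?_⟩
  obtain ⟨n, hn, hf⟩ := h k
  obtain ⟨n', hn', hf'⟩ := h' k
  refine ⟨n + n', ?_, ?_⟩
  · rw [Submodule.coe_add, hn, hn']; ring
  · rw [map_add, hf, hf', smul_add]; abel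

lemma Rel.neg {m : M} {z : ℤ} (h1 : Rel H f g m z) : Rel H f g (-m) (-z) := by
  obtain ⟨x, r, hx, hr, h⟩ := h1
  refine ⟨-x, -r, by simp [hx], by rw [map_neg, hr], fun k => ?_⟩
  obtain ⟨n, hn, hf⟩ := h k
  refine ⟨-n, ?_, ?_⟩
  · rw [Submodule.coe_neg, hn]; ring
  · rw [map_neg, hf, smul_neg]; abel

lemma Rel.zero_dvd [Fintype H] (hf : Function.Injective f)
    (hex : LinearMap.ker g = LinearMap.range f) {z : ℤ} (h1 : Rel H f g 0 z) :
    (Nat.card H : ℤ) ∣ z := by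
  obtain ⟨x, r, hx, hr, h⟩ := h1
  have hx' : x ∈ LinearMap.range f := by rw [← hex]; exact hx
  obtain ⟨n0, rfl⟩ := hx'
  obtain ⟨y, hy⟩ := fixed H (r - n0) (fun k => by
    obtain ⟨n, hn, hfn⟩ := h k
    rw [← map_smul, ← map_sub] at hfn
    have := hf hfn
    rw [this] at hn
    simp only [Submodule.coe_sub, Submodule.coe_smul, smul_eq_mul] at hn
    rw [mul_sub]
    linear_combination -hn)
  have h3 := congrArg aug hy
  have h4 : aug (n0 : MonoidAlgebra ℤ Γ) = 0 := mem_aug.1 n0.2.1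
  rw [map_sub, h4, hr, map_mul, aug_T, sub_zero] at h3
  exact ⟨_, h3⟩

lemma Rel.exists [Fintype H] (hf : Function.Injective f) (hg : Function.Surjective g)
    (hex : LinearMap.ker g = LinearMap.range f) {m : M} (hm : m ∈ fixedAddSubgroup Γ H M) :
    ∃ z, Rel H f g m z := by
  obtain ⟨x, rfl⟩ := hg m
  have : ∀ h : H, ∃ n, f n = MonoidAlgebra.of ℤ Γ (h : Γ) • x - x := by
    intro h
    have : MonoidAlgebra.of ℤ Γ (h : Γ) • x - x ∈ LinearMap.ker g := by
      rw [LinearMap.mem_ker, map_sub, map_smul, hm h, sub_self]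
    rw [hex] at this
    exact this
  choose n hn using this
  obtain ⟨r, hr⟩ := cocycle H (fun h => (n h : MonoidAlgebra ℤ Γ)) (fun k h => by
    have : n (k * h) = n k + MonoidAlgebra.of ℤ Γ (k : Γ) • n h := by
      apply hf
      rw [map_add, map_smul, hn, hn, hn, Subgroup.coe_mul, map_mul, mul_smul, smul_sub]
      abel
    rw [this]; rfl)
  exact ⟨_, x, r, rfl, rfl, fun h => ⟨n h, hr h, hn h⟩⟩

lemma Rel.of_mem_trace [Fintype H] (hg : Function.Surjective g) {m : M}
    (hm : m ∈ traceAddSubgroup Γ H M) : Rel H f g m 0 := by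
  obtain ⟨m', rfl⟩ := hm
  obtain ⟨x, rfl⟩ := hg m'
  refine ⟨(∑ h : H, MonoidAlgebra.of ℤ Γ (h : Γ)) • x, 0, ?_, map_zero _, fun h => ⟨0, ?_, ?_⟩⟩
  · rw [map_smul]; rfl
  · simp
  · rw [map_zero, smul_smul, T_fixed, sub_self]

lemma Rel.mem_trace [Fintype H] (hp : p.Prime) (hH : ∃ h : H, ψ (h : Γ) ≠ 1)
    (hex : LinearMap.ker g = LinearMap.range f) {m : M} {z : ℤ}
    (h1 : Rel H f g m z) (hz : (Nat.card H : ℤ) ∣ z) : m ∈ traceAddSubgroup Γ H M := by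
  haveI := Fact.mk hp
  obtain ⟨x, r, hx, hr, h⟩ := h1
  obtain ⟨k, rfl⟩ := hz
  set T : MonoidAlgebra ℤ Γ := ∑ h : H, MonoidAlgebra.of ℤ Γ (h : Γ) with hT
  set r' : MonoidAlgebra ℤ Γ := r - T * (k : MonoidAlgebra ℤ Γ) with hr'
  have hfix : ∀ h : H, MonoidAlgebra.of ℤ Γ (h : Γ) * r' - r' =
      MonoidAlgebra.of ℤ Γ (h : Γ) * r - r := by
    intro h
    rw [hr', mul_sub, ← mul_assoc, T_fixed]; ring
  have haug : aug r' = 0 := by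
    rw [hr', map_sub, map_mul, aug_T, hr, map_intCast]; simp
  have hJ : r' ∈ charKernelIdeal Γ p ψ := by
    obtain ⟨h0, hh0⟩ := hH
    obtain ⟨n, hn, -⟩ := h h0
    have h2 : (n : MonoidAlgebra ℤ Γ) ∈ charKernelIdeal Γ p ψ := n.2.2
    rw [hn, ← hfix] at h2
    unfold charKernelIdeal at h2 ⊢
    rw [RingHom.mem_ker] at h2 ⊢
    rw [map_sub, map_mul, MonoidAlgebra.lift_of, ← sub_one_mul, mul_eq_zero] at h2
    refine h2.resolve_left fun h3 => hh0 ?_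
    rw [sub_eq_zero] at h3
    exact Units.ext h3
  let n0 : ↥(augmentationIdeal Γ ⊓ charKernelIdeal Γ p ψ) := ⟨r', mem_aug.2 haug, hJ⟩
  obtain ⟨y, hy⟩ := fixed H ((x - f n0 : augmentationIdeal Γ) : MonoidAlgebra ℤ Γ) (fun h' => by
    obtain ⟨n, hn, hfn⟩ := h h'
    have h5 : n = MonoidAlgebra.of ℤ Γ (h' : Γ) • n0 - n0 := by
      apply Subtype.ext
      rw [hn, ← hfix]; rfl
    rw [h5, map_sub, map_smul] at hfn
    have h6 := congrArg (Subtype.val) hfn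
    simp only [Submodule.coe_sub, Submodule.coe_smul, smul_eq_mul] at h6 ⊢
    rw [mul_sub]
    linear_combination -h6)
  have hy0 : aug y = 0 := by
    have h7 : aug ((x - f n0 : augmentationIdeal Γ) : MonoidAlgebra ℤ Γ) = 0 :=
      mem_aug.1 (x - f n0).2
    rw [hy, map_mul, aug_T, mul_eq_zero] at h7
    refine h7.resolve_left ?_
    exact_mod_cast Nat.card_pos.ne'
  have h8 : x - f n0 = T • (⟨y, mem_aug.2 hy0⟩ : augmentationIdeal Γ) := Subtype.ext hy
  have h9 : g (f n0) = 0 := by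
    rw [← LinearMap.mem_ker, hex]; exact ⟨_, rfl⟩
  refine ⟨g ⟨y, mem_aug.2 hy0⟩, ?_⟩
  have h10 := congrArg g h8
  rw [map_sub, h9, sub_zero, hx, map_smul] at h10
  exact h10.symm

end TateAux

/-- Let `Γ` be a finite abelian group, `p` a prime, `ψ : Γ → (ℤ/pℤ)ˣ` a homomorphism,
`𝒥 = ker(ℤ[Γ] → ℤ/pℤ)`, `I_Γ` the augmentation ideal, and `H ⊆ Γ` a subgroup on which
`ψ` is nontrivial. If `M` is a `ℤ[Γ]`-module fitting into a short exact sequence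
`0 → I_Γ ∩ 𝒥 → I_Γ → M → 0`, then the Tate cohomology group
`Ĥ⁰(H, M) = M^H / T_H·M` is a cyclic group whose order divides `#H`. -/
theorem tateH0_of_cuspidal_presentation
    (Γ : Type) [CommGroup Γ] [Fintype Γ] (p : ℕ) (hp : p.Prime)
    (ψ : Γ →* (ZMod p)ˣ) (H : Subgroup Γ) [Fintype H] (hH : ∃ h : H, ψ (h : Γ) ≠ 1)
    (M : Type) [AddCommGroup M] [Module (MonoidAlgebra ℤ Γ) M]
    (hseq : ∃ (f : ↥(augmentationIdeal Γ ⊓ charKernelIdeal Γ p ψ) →ₗ[MonoidAlgebra ℤ Γ]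
          ↥(augmentationIdeal Γ))
        (g : ↥(augmentationIdeal Γ) →ₗ[MonoidAlgebra ℤ Γ] M),
        Function.Injective f ∧ Function.Surjective g ∧
          LinearMap.ker g = LinearMap.range f) :
    IsAddCyclic
        (↥(fixedAddSubgroup Γ H M) ⧸
          (traceAddSubgroup Γ H M).addSubgroupOf (fixedAddSubgroup Γ H M)) ∧
      Nat.card
          (↥(fixedAddSubgroup Γ H M) ⧸
            (traceAddSubgroup Γ H M).addSubgroupOf (fixedAddSubgroup Γ H M)) ∣
        Nat.card H := by
  obtain ⟨f, g, hf, hg, hex⟩ := hseq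
  have hE : ∀ m : fixedAddSubgroup Γ H M, ∃ z, TateAux.Rel H f g (m : M) z :=
    fun m => TateAux.Rel.exists hf hg hex m.2
  choose c hc using hE
  have huniq : ∀ (m : M) (z z' : ℤ), TateAux.Rel H f g m z → TateAux.Rel H f g m z' →
      (z : ZMod (Nat.card H)) = z' := by
    intro m z z' h h'
    have h1 := h'.add h.neg
    rw [add_neg_cancel] at h1
    have h2 := h1.zero_dvd hf hex
    rw [← sub_eq_add_neg] at h2
    exact (ZMod.intCast_eq_intCast_iff_dvd_sub _ _ _).2 h2
  let φ : fixedAddSubgroup Γ H M →+ ZMod (Nat.card H) :=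
    AddMonoidHom.mk' (fun m => (c m : ZMod (Nat.card H))) (fun a b => by
      rw [← Int.cast_add]
      exact huniq _ _ _ (hc (a + b)) ((hc a).add (hc b)))
  have hker : (traceAddSubgroup Γ H M).addSubgroupOf (fixedAddSubgroup Γ H M) = φ.ker := by
    ext m
    rw [AddSubgroup.mem_addSubgroupOf, AddMonoidHom.mem_ker]
    constructor
    · intro hm
      have := huniq _ _ _ (hc m) (TateAux.Rel.of_mem_trace hg hm)
      rw [Int.cast_zero] at this
      exact this
    · intro hm
      exact (hc m).mem_trace hp hH hex ((ZMod.intCast_zmod_eq_zero_iff_dvd _ _).1 hm)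
  let e := (QuotientAddGroup.quotientAddEquivOfEq hker).trans
    (QuotientAddGroup.quotientKerEquivRange φ)
  constructor
  · exact isAddCyclic_of_injective e.toAddMonoidHom e.injective
  · rw [Nat.card_congr e.toEquiv]
    have := AddSubgroup.card_addSubgroup_dvd_card φ.range
    rwa [Nat.card_zmod] at this
end
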